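/- Let r ≥ 0 and 0 ≤ t ≤ s be integers and let n ≥ 0 be an integer. Then: (i) pr_t(fil_n W_s(K)) = fil^{(s-t)}_n W_t(K); (ii) (F−1)^{-1}(fil^{(r)}_n W_s(K)) = fil^{(r)}_{[n/p]} W_s(K). -/

import Mathlib

/-!
Setting: `K` is a (complete) discrete valuation field of characteristic `p > 0`, with
normalized additive valuation `v = ord_K : K → ℤ ∪ {∞}` (normalization is expressed by
the existence of a uniformizer `π` with `v π = 1`).

`W_s(K)` is the ring of `p`-typical Witt vectors of length `s` over `K`.  Following the
paper, a Witt vector is written `a = (a_{s-1}, …, a_0)`, where the paper's component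
`a_i` is the component of standard index `s - 1 - i` (so `a_{s-1}` is the leading
component and the Verschiebung `V` sends `(a_{s-1}, …, a_0)` to `(0, a_{s-1}, …, a_0)`,
i.e. it is the standard index shift).  We realize `W_s(K)` as `TruncatedWittVector p s K`.
-/

noncomputable section

open TruncatedWittVector

variable (p : ℕ) [Fact p.Prime] (K : Type*) [Field K] [CharP K p]
variable (v : AddValuation K (WithTop ℤ))

/-- The Frobenius `F : W_s(K) → W_s(K)`, raising each component to the `p`-th power. -/
def frobW {s : ℕ} (a : TruncatedWittVector p s K) : TruncatedWittVector p s K :=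
  TruncatedWittVector.mk p fun i => a.coeff i ^ p

/-- The `k`-fold Verschiebung `V^k : W_t(K) → W_s(K)` (for `t + k = s`), shifting
components: in the paper's notation it sends `(a_{t-1}, …, a_0)` to
`(0, …, 0, a_{t-1}, …, a_0)`. -/
def VShift (k : ℕ) {t : ℕ} (s : ℕ) (a : TruncatedWittVector p t K) :
    TruncatedWittVector p s K :=
  TruncatedWittVector.mk p fun i =>
    if h : k ≤ (i : ℕ) ∧ (i : ℕ) - k < t then a.coeff ⟨(i : ℕ) - k, h.2⟩ else 0

/-- The truncation `pr_t : W_s(K) → W_t(K)`, `(a_{s-1}, …, a_0) ↦ (a_{s-1}, …, a_{s-t})`. -/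
def prW {s : ℕ} (t : ℕ) (ht : t ≤ s) (a : TruncatedWittVector p s K) :
    TruncatedWittVector p t K :=
  TruncatedWittVector.mk p fun i => a.coeff (Fin.castLE ht i)

/-- `ord_K(a) = min_{0 ≤ i ≤ s-1} p^i · ord_K(a_i)` for a Witt vector
`a = (a_{s-1}, …, a_0) ∈ W_s(K)` (the paper's component `a_i` has standard index
`s - 1 - i`, whence the weight `p ^ (s - 1 - i)` below). -/
def wittOrd {s : ℕ} (a : TruncatedWittVector p s K) : WithTop ℤ :=
  Finset.univ.inf fun i : Fin s => p ^ (s - 1 - (i : ℕ)) • v (a.coeff i)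

/-- Brylinski--Kato filtration `fil_n W_s(K) = {a ∈ W_s(K) | ord_K(a) ≥ -n}`. -/
def filW (s : ℕ) (n : ℤ) : Set (TruncatedWittVector p s K) :=
  {a | ((-n : ℤ) : WithTop ℤ) ≤ wittOrd p K v a}

/-- `fil^{(r)}_n W_s(K) = fil_{[n/p^r]} W_s(K)` (for `n ≥ 0`). -/
def filWr (s r : ℕ) (n : ℕ) : Set (TruncatedWittVector p s K) :=
  filW p K v s ((n / p ^ r : ℕ) : ℤ)

/-- Matsuda's filtration
`fil'_m W_s(K) = fil_{m-1} W_s(K) + V^{s-s'}(fil_m W_{s'}(K))`, `s' = min(ord_p m, s)`. -/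
def filW' (s m : ℕ) : Set (TruncatedWittVector p s K) :=
  {a | ∃ b ∈ filW p K v s ((m : ℤ) - 1),
      ∃ c ∈ filW p K v (min (padicValNat p m) s) (m : ℤ),
        a = b + VShift p K (s - min (padicValNat p m) s) s c}

/-- `fil'^{(r)}_m W_s(K) = fil^{(r)}_{m-1} W_s(K) + V^{s-s''}(fil^{(r)}_m W_{s''}(K))`,
where `s'' = max(0, min(ord_p m, s + r) - r)`. -/
def filW'r (s r m : ℕ) : Set (TruncatedWittVector p s K) :=
  {a | ∃ b ∈ filWr p K v s r (m - 1),
      ∃ c ∈ filWr p K v (min (padicValNat p m) (s + r) - r) r m,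
        a = b + VShift p K (s - (min (padicValNat p m) (s + r) - r)) s c}

/-- `fil''^{(r)}_m W_s(K) = fil^{(r)}_{[(m-1)/p]} W_s(K) + V^{s-s''}(fil^{(r)}_{[m/p]} W_{s''}(K))`,
where `s'' = max(0, min(ord_p m, s + r) - r)`. -/
def filW''r (s r m : ℕ) : Set (TruncatedWittVector p s K) :=
  {a | ∃ b ∈ filWr p K v s r ((m - 1) / p),
      ∃ c ∈ filWr p K v (min (padicValNat p m) (s + r) - r) r (m / p),
        a = b + VShift p K (s - (min (padicValNat p m) (s + r) - r)) s c}

/-- `fil''_m W_s(K) = fil''^{(0)}_m W_s(K)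
  = fil_{[(m-1)/p]} W_s(K) + V^{s-s'}(fil_{[m/p]} W_{s'}(K))`. -/
def filW'' (s m : ℕ) : Set (TruncatedWittVector p s K) :=
  filW''r p K v s 0 m

section WeightedHomogeneous

open MvPolynomial

theorem MvPolynomial.IsWeightedHomogeneous.of_C_mul {σ R M : Type*} [CommRing R] [IsDomain R]
    [AddCommMonoid M] {w : σ → M} {m : M} {c : R} (hc : c ≠ 0) {φ : MvPolynomial σ R}
    (h : IsWeightedHomogeneous w (C c * φ) m) : IsWeightedHomogeneous w φ m :=
  fun d hd => h (by rw [coeff_C_mul]; exact mul_ne_zero hc hd)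

/-- The polynomial `S_n` giving the `n`-th component of a difference of Witt vectors is
isobaric of weight `p ^ n`, where the variables of index `i` have weight `p ^ i`. -/
theorem WittVector.isWeightedHomogeneous_wittSub (p : ℕ) [hp : Fact p.Prime] (n : ℕ) :
    IsWeightedHomogeneous (fun j : Fin 2 × ℕ => p ^ j.2) (WittVector.wittSub p n) (p ^ n) := by
  induction n using Nat.strong_induction_on with
  | _ n ih =>
  have hghost (i : Fin 2) : IsWeightedHomogeneous (fun j : Fin 2 × ℕ => p ^ j.2)
      (rename (Prod.mk i) (wittPolynomial p ℤ n)) (p ^ n) := by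
    rw [wittPolynomial_eq_sum_C_mul_X_pow, map_sum]
    refine IsWeightedHomogeneous.sum _ _ _ fun k hk => ?_
    rw [map_mul, rename_C, map_pow (rename _), rename_X]
    refine IsWeightedHomogeneous.C_mul ?_ _
    have := (isWeightedHomogeneous_X ℤ (fun j : Fin 2 × ℕ => p ^ j.2) (i, k)).pow (p ^ (n - k))
    rwa [smul_eq_mul, ← pow_add, Nat.sub_add_cancel (by simp at hk; omega)] at this
  have hlower : IsWeightedHomogeneous (fun j : Fin 2 × ℕ => p ^ j.2)
      (∑ k ∈ Finset.range n, C ((p : ℤ) ^ k) * WittVector.wittSub p k ^ p ^ (n - k)) (p ^ n) := by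
    refine IsWeightedHomogeneous.sum _ _ _ fun k hk => IsWeightedHomogeneous.C_mul ?_ _
    have hk := Finset.mem_range.1 hk
    have := (ih k hk).pow (p ^ (n - k))
    rwa [smul_eq_mul, ← pow_add, Nat.sub_add_cancel hk.le] at this
  have key : C ((p : ℤ) ^ n) * WittVector.wittSub p n =
      rename (Prod.mk 0) (wittPolynomial p ℤ n) - rename (Prod.mk 1) (wittPolynomial p ℤ n) -
        ∑ k ∈ Finset.range n, C ((p : ℤ) ^ k) * WittVector.wittSub p k ^ p ^ (n - k) := by
    have h := wittStructureInt_prop p (X 0 - X 1 : MvPolynomial (Fin 2) ℤ) n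
    rw [map_sub, bind₁_X_right, bind₁_X_right] at h
    rw [← h, wittPolynomial_eq_sum_C_mul_X_pow, Finset.sum_range_succ, map_add, map_sum,
      eq_sub_iff_add_eq']
    simp only [map_mul, bind₁_C_right, map_pow (bind₁ _), bind₁_X_right, Nat.sub_self, pow_zero,
      pow_one, WittVector.wittSub]
  refine IsWeightedHomogeneous.of_C_mul (c := (p : ℤ) ^ n)
    (pow_ne_zero _ (mod_cast hp.out.ne_zero)) ?_
  rw [key]
  exact ((hghost 0).sub (hghost 1)).sub hlower

end WeightedHomogeneous

section Valuation

variable {R Γ : Type*} [LinearOrderedAddCommMonoidWithTop Γ]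

theorem nsmul_top_of_ne_zero {c : ℕ} (hc : c ≠ 0) : c • (⊤ : Γ) = ⊤ := by
  obtain ⟨k, rfl⟩ := Nat.exists_eq_succ_of_ne_zero hc
  rw [succ_nsmul, add_top]

theorem AddValuation.intCast_nonneg [Ring R] (v : AddValuation R Γ) (k : ℤ) :
    0 ≤ v (k : R) := by
  induction k with
  | zero => simp
  | succ i ih => push_cast at ih ⊢; exact v.map_le_add ih (by simp)
  | pred i ih => push_cast at ih ⊢; exact v.map_le_sub ih (by simp)

theorem AddValuation.nsmul_le_nsmul_aeval [CommRing R] (v : AddValuation R Γ) {σ : Type*}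
    {w : σ → ℕ} {m c : ℕ} (hc : c ≠ 0) {φ : MvPolynomial σ ℤ}
    (hφ : φ.IsWeightedHomogeneous w m) {f : σ → R} {g : Γ} (h : ∀ j, w j • g ≤ c • v (f j)) :
    m • g ≤ c • v (MvPolynomial.aeval f φ) := by
  rw [MvPolynomial.aeval_def, MvPolynomial.eval₂_eq]
  refine Finset.sum_induction _ (fun x => m • g ≤ c • v x) (fun x y hx hy => ?_) ?_ fun d hd => ?_
  · rcases min_le_iff.1 (v.map_add x y) with hxy | hxy
    · exact hx.trans (nsmul_le_nsmul_right hxy c)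
    · exact hy.trans (nsmul_le_nsmul_right hxy c)
  · rw [v.map_zero, nsmul_top_of_ne_zero hc]
    exact le_top
  · have hprod (s : Finset σ) :
        (∑ i ∈ s, d i * w i) • g ≤ c • v (∏ i ∈ s, f i ^ d i) := by
      classical
      induction s using Finset.induction_on with
      | empty => simp
      | insert i s hi ih =>
        rw [Finset.sum_insert hi, Finset.prod_insert hi, v.map_mul, add_nsmul, nsmul_add, v.map_pow,
          mul_nsmul', smul_comm c]
        exact add_le_add (nsmul_le_nsmul_right (h i) _) ih
    have hw : ∑ i ∈ d.support, d i * w i = m := by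
      rw [← hφ (MvPolynomial.mem_support_iff.1 hd), Finsupp.weight_apply, Finsupp.sum]
      simp
    rw [v.map_mul, nsmul_add, ← hw]
    exact (hprod _).trans (le_add_of_nonneg_left
      (nsmul_nonneg (by simpa using v.intCast_nonneg _) c))

theorem WithTop.coe_neg_le_nsmul_iff {c : ℕ} (hc : 0 < c) (k : ℕ) (x : WithTop ℤ) :
    ((-(k : ℤ) : ℤ) : WithTop ℤ) ≤ c • x ↔ ((-((k / c : ℕ) : ℤ) : ℤ) : WithTop ℤ) ≤ x := by
  induction x with
  | top => simp [nsmul_top_of_ne_zero hc.ne']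
  | coe x =>
    rw [← WithTop.coe_nsmul, WithTop.coe_le_coe, WithTop.coe_le_coe, nsmul_eq_mul, Int.natCast_div,
      neg_le, neg_le (b := x), ← mul_neg, Int.le_ediv_iff_mul_le (by exact_mod_cast hc), mul_comm]

theorem WithTop.nsmul_le_nsmul_iff_of_pos {c : ℕ} (hc : 0 < c) (k : ℤ) (x : WithTop ℤ) :
    c • (k : WithTop ℤ) ≤ c • x ↔ (k : WithTop ℤ) ≤ x := by
  induction x with
  | top => simp [nsmul_top_of_ne_zero hc.ne']
  | coe x =>
    rw [← WithTop.coe_nsmul, ← WithTop.coe_nsmul, WithTop.coe_le_coe, WithTop.coe_le_coe,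
      nsmul_le_nsmul_iff_right hc.ne']

end Valuation

section Filtration

variable {p : ℕ} {K : Type*} [Field K] {v : AddValuation K (WithTop ℤ)} {s : ℕ}

theorem mem_filW_iff {n : ℤ} {a : TruncatedWittVector p s K} :
    a ∈ filW p K v s n ↔
      ∀ i : Fin s, ((-n : ℤ) : WithTop ℤ) ≤ p ^ (s - 1 - (i : ℕ)) • v (a.coeff i) := by
  simp [filW, wittOrd, Finset.le_inf_iff]

theorem filW_mono {m n : ℤ} (h : m ≤ n) : filW p K v s m ⊆ filW p K v s n :=
  fun _ ha => le_trans (WithTop.coe_le_coe.2 (neg_le_neg h)) ha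

theorem exists_mem_filW (a : TruncatedWittVector p s K) : ∃ N : ℕ, a ∈ filW p K v s (N : ℤ) := by
  obtain ⟨k, hk⟩ : ∃ k : ℤ, (k : WithTop ℤ) ≤ wittOrd p K v a := by
    cases wittOrd p K v a with
    | top => exact ⟨0, le_top⟩
    | coe k => exact ⟨k, le_rfl⟩
  exact ⟨(-k).toNat, le_trans (WithTop.coe_le_coe.2 (by omega)) hk⟩

variable [Fact p.Prime]

theorem zero_mem_filW (n : ℤ) : (0 : TruncatedWittVector p s K) ∈ filW p K v s n := by
  refine mem_filW_iff.2 fun i => ?_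
  rw [TruncatedWittVector.coeff_zero, v.map_zero,
    nsmul_top_of_ne_zero (pow_ne_zero _ (Fact.out : p.Prime).ne_zero)]
  exact le_top

theorem le_nsmul_coeff_iff {n : ℤ} {i : ℕ} (hi : i < s) (x : WithTop ℤ) :
    p ^ i • ((-n : ℤ) : WithTop ℤ) ≤ p ^ (s - 1) • x ↔
      ((-n : ℤ) : WithTop ℤ) ≤ p ^ (s - 1 - i) • x := by
  have hs : p ^ (s - 1) = p ^ i * p ^ (s - 1 - i) := by
    rw [← pow_add, Nat.add_sub_cancel' (by omega)]
  rw [hs, mul_nsmul', WithTop.nsmul_le_nsmul_iff_of_pos (pow_pos (Fact.out : p.Prime).pos _)]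

theorem sub_mem_filW {n : ℤ} {a b : TruncatedWittVector p s K} (ha : a ∈ filW p K v s n)
    (hb : b ∈ filW p K v s n) : a - b ∈ filW p K v s n := by
  have hp : p ^ (s - 1) ≠ 0 := pow_ne_zero _ (Fact.out : p.Prime).ne_zero
  have hout {x : TruncatedWittVector p s K} (hx : x ∈ filW p K v s n) (j : ℕ) :
      p ^ j • ((-n : ℤ) : WithTop ℤ) ≤ p ^ (s - 1) • v (x.out.coeff j) := by
    by_cases hj : j < s
    · rw [le_nsmul_coeff_iff hj]
      simpa using (mem_filW_iff.1 hx ⟨j, hj⟩).trans_eq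
        (by rw [← TruncatedWittVector.coeff_out])
    · have : x.out.coeff j = 0 := by simp [TruncatedWittVector.out, hj]
      rw [this, v.map_zero, nsmul_top_of_ne_zero hp]
      exact le_top
  refine mem_filW_iff.2 fun i => ?_
  have hcoeff : (a - b).coeff i = (a.out - b.out).coeff i :=
    WittVector.coeff_truncateFun (a.out - b.out) i
  rw [hcoeff, ← le_nsmul_coeff_iff i.2, WittVector.sub_coeff]
  refine v.nsmul_le_nsmul_aeval hp (WittVector.isWeightedHomogeneous_wittSub p i) ?_
  rintro ⟨k, j⟩
  fin_cases k
  · exact hout ha j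
  · exact hout hb j

theorem add_mem_filW {n : ℤ} {a b : TruncatedWittVector p s K} (ha : a ∈ filW p K v s n)
    (hb : b ∈ filW p K v s n) : a + b ∈ filW p K v s n := by
  simpa using sub_mem_filW ha (sub_mem_filW (zero_mem_filW n) hb)

theorem frobW_mem_filW_iff {k : ℕ} {a : TruncatedWittVector p s K} :
    frobW p K a ∈ filW p K v s (k : ℤ) ↔ a ∈ filW p K v s ((k / p : ℕ) : ℤ) := by
  rw [mem_filW_iff, mem_filW_iff]
  refine forall_congr' fun i => ?_
  rw [frobW, TruncatedWittVector.coeff_mk, v.map_pow, smul_comm,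
    WithTop.coe_neg_le_nsmul_iff (Fact.out : p.Prime).pos]

theorem frobW_sub_self_mem_filW_iff {m : ℕ} {a : TruncatedWittVector p s K} :
    frobW p K a - a ∈ filW p K v s (m : ℤ) ↔ a ∈ filW p K v s ((m / p : ℕ) : ℤ) := by
  classical
  have hp : p.Prime := Fact.out
  refine ⟨fun h => ?_, fun h => sub_mem_filW (frobW_mem_filW_iff.2 h)
    (filW_mono (mod_cast Nat.div_le_self m p) h)⟩
  obtain ⟨N, hN, hmin⟩ : ∃ N : ℕ, a ∈ filW p K v s (N : ℤ) ∧ ∀ M < N, a ∉ filW p K v s (M : ℤ) :=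
    have ha := exists_mem_filW (v := v) a
    ⟨Nat.find ha, Nat.find_spec ha, fun _ => Nat.find_min ha⟩
  by_contra hcon
  have hlt : m / p < N := by
    by_contra! hle
    exact hcon (filW_mono (mod_cast hle) hN)
  have hm : m < N * p := (Nat.div_lt_iff_lt_mul hp.pos).1 hlt
  have hNp : N < N * p := lt_mul_of_one_lt_right ((Nat.zero_le _).trans_lt hlt) hp.one_lt
  have hF : frobW p K a ∈ filW p K v s ((N * p - 1 : ℕ) : ℤ) := by
    rw [← sub_add_cancel (frobW p K a) a]
    exact add_mem_filW (filW_mono (Int.ofNat_le.2 (by omega)) h)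
      (filW_mono (Int.ofNat_le.2 (by omega)) hN)
  exact hmin _ ((Nat.div_lt_iff_lt_mul hp.pos).2 (by omega)) (frobW_mem_filW_iff.1 hF)

theorem image_prW_filW {t : ℕ} (ht : t ≤ s) (n : ℕ) :
    prW p K t ht '' filW p K v s (n : ℤ) = filWr p K v t (s - t) n := by
  have hp : p.Prime := Fact.out
  have key (i : Fin t) (x : WithTop ℤ) :
      ((-(n : ℤ) : ℤ) : WithTop ℤ) ≤ p ^ (s - 1 - (i : ℕ)) • x ↔
        ((-((n / p ^ (s - t) : ℕ) : ℤ) : ℤ) : WithTop ℤ) ≤ p ^ (t - 1 - (i : ℕ)) • x := by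
    have hs : s - 1 - (i : ℕ) = s - t + (t - 1 - i) := by omega
    rw [hs, pow_add, mul_nsmul', WithTop.coe_neg_le_nsmul_iff (pow_pos hp.pos _)]
  ext b
  rw [filWr, mem_filW_iff]
  constructor
  · rintro ⟨a, ha, rfl⟩ i
    rw [← key, prW, TruncatedWittVector.coeff_mk]
    exact mem_filW_iff.1 ha (Fin.castLE ht i)
  · intro hb
    refine ⟨TruncatedWittVector.mk p fun i => if h : (i : ℕ) < t then b.coeff ⟨i, h⟩ else 0,
      mem_filW_iff.2 fun i => ?_, ?_⟩
    · rw [TruncatedWittVector.coeff_mk]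
      split_ifs with h
      · exact (key ⟨i, h⟩ _).2 (hb ⟨i, h⟩)
      · rw [v.map_zero, nsmul_top_of_ne_zero (pow_ne_zero _ hp.ne_zero)]
        exact le_top
    · ext i
      simp [prW, TruncatedWittVector.coeff_mk]

end Filtration

/-- Lemma 1.8 of the paper.  For integers `r ≥ 0`, `0 ≤ t ≤ s`, `n ≥ 0`:
(i) `pr_t(fil_n W_s(K)) = fil^{(s-t)}_n W_t(K)`;
(ii) `(F-1)⁻¹(fil^{(r)}_n W_s(K)) = fil^{(r)}_{[n/p]} W_s(K)`. -/
theorem statement2 (hv : ∃ π : K, v π = 1) (s t r n : ℕ) (ht : t ≤ s) :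
    (prW p K t ht '' (filW p K v s (n : ℤ)) = filWr p K v t (s - t) n) ∧
    ((fun a : TruncatedWittVector p s K => frobW p K a - a) ⁻¹' (filWr p K v s r n)
        = filWr p K v s r (n / p)) := by
  refine ⟨image_prW_filW ht n, Set.ext fun a => ?_⟩
  rw [Set.mem_preimage, filWr, filWr, frobW_sub_self_mem_filW_iff, Nat.div_div_eq_div_mul,
    Nat.div_div_eq_div_mul, mul_comm]
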